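/- Let (M,d) be a complete cone metric space over a real Banach space E with cone P, where P is normal with normal constant K. Suppose S, T : M → M form a pair of generalized Zamfirescu operators (with some constants a, b, c) such that (a) T is sequentially continuous, (b) S(M) ⊆ T(M), and (c) S and T commute. Then S and T have a unique common fixed point. -/

import Mathlib

/-- `P` is a cone in the real Banach space `E`. -/
def IsCone {E : Type*} [NormedAddCommGroup E] [NormedSpace ℝ E] (P : Set E) : Prop :=
  IsClosed P ∧ P.Nonempty ∧ P ≠ {0} ∧
    (∀ a b : ℝ, 0 ≤ a → 0 ≤ b → ∀ x ∈ P, ∀ y ∈ P, a • x + b • y ∈ P) ∧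
    P ∩ (-P) = {0}

/-- The partial order induced by the cone `P`: `x ≤ y` iff `y - x ∈ P`. -/
def ConeLe {E : Type*} [NormedAddCommGroup E] [NormedSpace ℝ E] (P : Set E) (x y : E) : Prop :=
  y - x ∈ P

/-- `x ≪ y` iff `y - x ∈ interior P`. -/
def ConeLt {E : Type*} [NormedAddCommGroup E] [NormedSpace ℝ E] (P : Set E) (x y : E) : Prop :=
  y - x ∈ interior P

/-- `P` is a normal cone with normal constant `K`. -/
def IsNormalCone {E : Type*} [NormedAddCommGroup E] [NormedSpace ℝ E] (P : Set E) (K : ℝ) : Prop :=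
  0 < K ∧ ∀ x y : E, ConeLe P 0 x → ConeLe P x y → ‖x‖ ≤ K * ‖y‖

/-- `d` is a cone metric on `M` with respect to the cone `P`. -/
def IsConeMetric {E M : Type*} [NormedAddCommGroup E] [NormedSpace ℝ E]
    (P : Set E) (d : M → M → E) : Prop :=
  (∀ x y : M, ConeLe P 0 (d x y)) ∧
  (∀ x y : M, d x y = 0 ↔ x = y) ∧
  (∀ x y : M, d x y = d y x) ∧
  (∀ x y z : M, ConeLe P (d x y) (d x z + d z y))

/-- Convergence of a sequence in a cone metric space. -/
def ConeConv {E M : Type*} [NormedAddCommGroup E] [NormedSpace ℝ E]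
    (P : Set E) (d : M → M → E) (u : ℕ → M) (x : M) : Prop :=
  ∀ c : E, ConeLt P 0 c → ∃ n₀ : ℕ, ∀ n ≥ n₀, ConeLt P (d (u n) x) c

/-- Cauchy sequences in a cone metric space. -/
def ConeCauchy {E M : Type*} [NormedAddCommGroup E] [NormedSpace ℝ E]
    (P : Set E) (d : M → M → E) (u : ℕ → M) : Prop :=
  ∀ c : E, ConeLt P 0 c → ∃ n₀ : ℕ, ∀ n ≥ n₀, ∀ m ≥ n₀, ConeLt P (d (u n) (u m)) c

/-- Completeness of a cone metric space. -/
def ConeComplete {E M : Type*} [NormedAddCommGroup E] [NormedSpace ℝ E]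
    (P : Set E) (d : M → M → E) : Prop :=
  ∀ u : ℕ → M, ConeCauchy P d u → ∃ x : M, ConeConv P d u x

/-- Sequential continuity of a self-map of a cone metric space. -/
def ConeSeqContinuous {E M : Type*} [NormedAddCommGroup E] [NormedSpace ℝ E]
    (P : Set E) (d : M → M → E) (T : M → M) : Prop :=
  ∀ (u : ℕ → M) (x : M), ConeConv P d u x → ConeConv P d (fun n => T (u n)) (T x)

/-- `(S, T)` is a pair of generalized Zamfirescu operators with constants `a`, `b`, `c`. -/
def IsGZO {E M : Type*} [NormedAddCommGroup E] [NormedSpace ℝ E]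
    (P : Set E) (d : M → M → E) (S T : M → M) (a b c : ℝ) : Prop :=
  0 ≤ a ∧ a < 1 ∧ 0 ≤ b ∧ b < 1/2 ∧ 0 ≤ c ∧ c < 1/2 ∧
    ∀ x y : M,
      ConeLe P (d (S x) (S y)) (a • d (T x) (T y)) ∨
      ConeLe P (d (S x) (S y)) (b • (d (S x) (T x) + d (S y) (T y))) ∨
      ConeLe P (d (S x) (S y)) (c • (d (S x) (T y) + d (S y) (T x)))

/-- `(S, T)` is a generalized weak contraction. -/
def IsGWC {E M : Type*} [NormedAddCommGroup E] [NormedSpace ℝ E]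
    (P : Set E) (d : M → M → E) (S T : M → M) : Prop :=
  ∃ δ L : ℝ, 0 < δ ∧ δ < 1 ∧ 0 ≤ L ∧
    ∀ x y : M, ConeLe P (d (S x) (S y)) (δ • d (T x) (T y) + L • d (S x) (T x))

open Filter Topology

section Cone

variable {E : Type*} [NormedAddCommGroup E] [NormedSpace ℝ E] {P : Set E}

theorem IsCone.add_mem (hP : IsCone P) {x y : E} (hx : x ∈ P) (hy : y ∈ P) : x + y ∈ P := by
  simpa using hP.2.2.2.1 1 1 zero_le_one zero_le_one x hx y hy

theorem IsCone.smul_mem (hP : IsCone P) {t : ℝ} (ht : 0 ≤ t) {x : E} (hx : x ∈ P) :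
    t • x ∈ P := by
  simpa using hP.2.2.2.1 t 0 ht le_rfl x hx x hx

theorem IsCone.zero_mem (hP : IsCone P) : (0 : E) ∈ P := by
  obtain ⟨x, hx⟩ := hP.2.1
  simpa using hP.smul_mem le_rfl hx

theorem IsCone.eq_zero (hP : IsCone P) {x : E} (hx : x ∈ P) (hx' : -x ∈ P) : x = 0 := by
  have h : x ∈ P ∩ (-P) := ⟨hx, hx'⟩
  rwa [hP.2.2.2.2] at h

theorem IsCone.coneLe_trans (hP : IsCone P) {x y z : E} (hxy : ConeLe P x y)
    (hyz : ConeLe P y z) : ConeLe P x z := by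
  have h := hP.add_mem hxy hyz
  rwa [show y - x + (z - y) = z - x by abel] at h

theorem IsCone.coneLe_smul (hP : IsCone P) {t : ℝ} (ht : 0 ≤ t) {x y : E}
    (h : ConeLe P x y) : ConeLe P (t • x) (t • y) := by
  have h := hP.smul_mem ht h
  rwa [smul_sub] at h

theorem IsCone.coneLe_smul_of_le (hP : IsCone P) {s t : ℝ} (hst : s ≤ t) {x : E} (hx : x ∈ P) :
    ConeLe P (s • x) (t • x) := by
  have h := hP.smul_mem (sub_nonneg.2 hst) hx
  rwa [sub_smul] at h

/-- A nonnegative element dominated by a proper multiple of itself vanishes. -/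
theorem IsCone.eq_zero_of_coneLe_smul (hP : IsCone P) {t : ℝ} (ht : t < 1) {x : E} (hx : x ∈ P)
    (h : ConeLe P x (t • x)) : x = 0 := by
  refine hP.eq_zero hx ?_
  have h' := hP.smul_mem (inv_nonneg.2 (sub_pos.2 ht).le) h
  have ht' : 1 - t ≠ 0 := (sub_pos.2 ht).ne'
  rwa [show t • x - x = (1 - t) • (-x) by module, smul_smul, inv_mul_cancel₀ ht', one_smul] at h'

/-- An element absorbing a fraction `s < 1` of itself can be solved for. -/
theorem IsCone.coneLe_of_coneLe_smul_add (hP : IsCone P) {s : ℝ} (hs : s < 1) {x y : E}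
    (h : ConeLe P x (s • x + s • y)) : ConeLe P x ((s / (1 - s)) • y) := by
  have h' := hP.smul_mem (inv_nonneg.2 (sub_pos.2 hs).le) h
  have hs' : 1 - s ≠ 0 := (sub_pos.2 hs).ne'
  rwa [show s • x + s • y - x = (1 - s) • ((s / (1 - s)) • y - x) by
    rw [smul_sub, smul_smul, mul_div_cancel₀ _ hs']; module,
    smul_smul, inv_mul_cancel₀ hs', one_smul] at h'

theorem IsCone.add_mem_interior (hP : IsCone P) {x y : E} (hx : x ∈ interior P) (hy : y ∈ P) :
    x + y ∈ interior P := by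
  refine interior_maximal (t := (· + y) '' interior P) ?_ ?_ ⟨x, hx, rfl⟩
  · rintro _ ⟨z, hz, rfl⟩
    exact hP.add_mem (interior_subset hz) hy
  · exact isOpenMap_add_right y _ isOpen_interior

theorem IsCone.smul_mem_interior (hP : IsCone P) {t : ℝ} (ht : 0 < t) {x : E}
    (hx : x ∈ interior P) : t • x ∈ interior P := by
  refine interior_maximal (t := (t • ·) '' interior P) ?_ ?_ ⟨x, hx, rfl⟩
  · rintro _ ⟨z, hz, rfl⟩
    exact hP.smul_mem ht.le (interior_subset hz)
  · exact isOpenMap_smul₀ ht.ne' _ isOpen_interior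

theorem IsNormalCone.tendsto_zero_of_coneLe {K : ℝ} (hK : IsNormalCone P K) {v w : ℕ → E}
    (hv : ∀ n, v n ∈ P) (hvw : ∀ n, ConeLe P (v n) (w n)) (hw : Tendsto w atTop (𝓝 0)) :
    Tendsto v atTop (𝓝 0) := by
  refine squeeze_zero_norm (fun n => hK.2 _ _ (by simpa [ConeLe] using hv n) (hvw n)) ?_
  simpa using hw.norm.const_mul K

end Cone

section ConeMetric

variable {E M : Type*} [NormedAddCommGroup E] [NormedSpace ℝ E] {P : Set E} {d : M → M → E}

theorem IsConeMetric.mem (hd : IsConeMetric P d) (x y : M) : d x y ∈ P := by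
  simpa [ConeLe] using hd.1 x y

theorem IsConeMetric.self (hd : IsConeMetric P d) (x : M) : d x x = 0 :=
  (hd.2.1 x x).2 rfl

theorem IsConeMetric.symm (hd : IsConeMetric P d) (x y : M) : d x y = d y x :=
  hd.2.2.1 x y

theorem IsConeMetric.triangle (hd : IsConeMetric P d) (x y z : M) :
    ConeLe P (d x y) (d x z + d z y) :=
  hd.2.2.2 x y z

theorem IsConeMetric.eq_of_coneLe_smul (hd : IsConeMetric P d) (hP : IsCone P) {t : ℝ}
    (ht : t < 1) {x y : M} (h : ConeLe P (d x y) (t • d x y)) : x = y :=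
  (hd.2.1 x y).1 (hP.eq_zero_of_coneLe_smul ht (hd.mem x y) h)

theorem ConeConv.tendsto {K : ℝ} (hP : IsCone P) (hint : (interior P).Nonempty)
    (hK : IsNormalCone P K) (hd : IsConeMetric P d) {u : ℕ → M} {x : M}
    (h : ConeConv P d u x) : Tendsto (fun n => d (u n) x) atTop (𝓝 0) := by
  obtain ⟨e, he⟩ := hint
  rw [NormedAddGroup.tendsto_nhds_zero]
  intro ε hε
  have hK0 := hK.1
  have hden : 0 < K * ‖e‖ + 1 := by positivity
  have ht : 0 < ε / (K * ‖e‖ + 1) := by positivity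
  obtain ⟨N, hN⟩ := h ((ε / (K * ‖e‖ + 1)) • e)
    (by simpa [ConeLt] using hP.smul_mem_interior ht he)
  filter_upwards [eventually_ge_atTop N] with n hn
  have hle := hK.2 _ _ (hd.1 _ _) (interior_subset (hN n hn))
  rw [norm_smul, Real.norm_of_nonneg ht.le] at hle
  calc ‖d (u n) x‖ ≤ K * (ε / (K * ‖e‖ + 1) * ‖e‖) := hle
    _ = ε * (K * ‖e‖ / (K * ‖e‖ + 1)) := by ring
    _ < ε * 1 := by
      gcongr
      rw [div_lt_one hden]
      linarith
    _ = ε := mul_one ε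

theorem IsConeMetric.eq_of_tendsto {K : ℝ} (hK : IsNormalCone P K)
    (hd : IsConeMetric P d) {u : ℕ → M} {x y : M}
    (hx : Tendsto (fun n => d (u n) x) atTop (𝓝 0))
    (hy : Tendsto (fun n => d (u n) y) atTop (𝓝 0)) : x = y := by
  have h : Tendsto (fun _ : ℕ => d x y) atTop (𝓝 0) := by
    refine hK.tendsto_zero_of_coneLe (fun _ => hd.mem x y) (fun n => ?_)
      (by simpa using hx.add hy)
    rw [hd.symm (u n) x]
    exact hd.triangle x y (u n)
  exact (hd.2.1 x y).1 (tendsto_nhds_unique tendsto_const_nhds h)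

/-- Consecutive distances that contract geometrically force the Cauchy property. -/
theorem coneCauchy_of_coneLe_geometric (hP : IsCone P) (hd : IsConeMetric P d) {δ : ℝ}
    (hδ0 : 0 ≤ δ) (hδ1 : δ < 1) {u : ℕ → M}
    (hu : ∀ n, ConeLe P (d (u (n + 1)) (u (n + 2))) (δ • d (u n) (u (n + 1)))) :
    ConeCauchy P d u := by
  set e := d (u 0) (u 1) with he
  have he_mem : e ∈ P := hd.mem _ _
  have hδ : 0 < 1 - δ := sub_pos.2 hδ1
  have hstep : ∀ n, ConeLe P (d (u n) (u (n + 1))) (δ ^ n • e) := by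
    intro n
    induction n with
    | zero => simpa [ConeLe, ← he] using hP.zero_mem
    | succ n ih =>
      have h := hP.coneLe_trans (hu n) (hP.coneLe_smul hδ0 ih)
      rwa [smul_smul, ← pow_succ'] at h
  have hsum : ∀ n k, ConeLe P (d (u n) (u (n + k))) ((δ ^ n * ((1 - δ ^ k) / (1 - δ))) • e) := by
    intro n k
    induction k with
    | zero => simpa [ConeLe, hd.self] using hP.zero_mem
    | succ k ih =>
      have h := hP.add_mem (hd.triangle (u n) (u (n + (k + 1))) (u (n + k)))
        (hP.add_mem ih (hstep (n + k)))
      have hcoef : δ ^ n * ((1 - δ ^ (k + 1)) / (1 - δ)) =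
          δ ^ n * ((1 - δ ^ k) / (1 - δ)) + δ ^ (n + k) := by
        field_simp
        ring
      rw [ConeLe, hcoef]
      convert h using 1
      rw [← add_assoc n k 1]
      module
  have htail : ∀ N n, N ≤ n → ConeLe P (d (u N) (u n)) ((δ ^ N / (1 - δ)) • e) := by
    intro N n hn
    obtain ⟨k, rfl⟩ := Nat.exists_eq_add_of_le hn
    refine hP.coneLe_trans (hsum N k) (hP.coneLe_smul_of_le ?_ he_mem)
    rw [div_eq_mul_one_div (δ ^ N)]
    gcongr
    linarith [pow_nonneg hδ0 k]
  intro c hc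
  have hlim : Tendsto (fun N : ℕ => c - (2 * (δ ^ N / (1 - δ))) • e) atTop (𝓝 c) := by
    have h := (((tendsto_pow_atTop_nhds_zero_of_lt_one hδ0 hδ1).div_const (1 - δ)).const_mul
      2).smul_const e
    simpa using h.const_sub c
  have hc' : interior P ∈ 𝓝 c := isOpen_interior.mem_nhds (by simpa [ConeLt] using hc)
  obtain ⟨N, hN⟩ := (hlim.eventually hc').exists
  refine ⟨N, fun n hn m hm => ?_⟩
  have htri := hd.triangle (u n) (u m) (u N)
  rw [hd.symm (u n) (u N)] at htri
  have h := hP.add_mem_interior hN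
    (hP.add_mem htri (hP.add_mem (htail N n hn) (htail N m hm)))
  rw [ConeLt]
  convert h using 1
  module

end ConeMetric

section Zamfirescu

variable {E M : Type*} [NormedAddCommGroup E] [NormedSpace ℝ E] {P : Set E} {d : M → M → E}
  {S T : M → M} {a b c : ℝ}

theorem div_one_sub_lt_one_of_lt_half {s : ℝ} (hs : s < 1 / 2) : s / (1 - s) < 1 := by
  rw [div_lt_one (by linarith)]
  linarith

/-- A generalized Zamfirescu pair is a generalized weak contraction. -/
theorem IsGZO.isGWC (hP : IsCone P) (hd : IsConeMetric P d) (h : IsGZO P d S T a b c) :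
    IsGWC P d S T := by
  obtain ⟨ha0, ha1, hb0, hb1, hc0, hc1, h⟩ := h
  have hb := div_one_sub_lt_one_of_lt_half hb1
  have hc := div_one_sub_lt_one_of_lt_half hc1
  refine ⟨max (1 / 2) (max a (max (b / (1 - b)) (c / (1 - c)))), 2,
    lt_max_of_lt_left (by norm_num), by simp [ha1, hb, hc]; norm_num, zero_le_two, fun x y => ?_⟩
  have key : ∀ s : ℝ, s ≤ max (1 / 2) (max a (max (b / (1 - b)) (c / (1 - c)))) → ∀ t : ℝ, t ≤ 2 →
      ConeLe P (d (S x) (S y)) (s • d (T x) (T y) + t • d (S x) (T x)) →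
      ConeLe P (d (S x) (S y)) (max (1 / 2) (max a (max (b / (1 - b)) (c / (1 - c)))) •
        d (T x) (T y) + (2 : ℝ) • d (S x) (T x)) := by
    intro s hs t ht hst
    refine hP.coneLe_trans hst ?_
    have h := hP.add_mem (hP.coneLe_smul_of_le hs (hd.mem (T x) (T y)))
      (hP.coneLe_smul_of_le ht (hd.mem (S x) (T x)))
    rw [ConeLe]
    convert h using 1
    module
  have solve : ∀ s : ℝ, s < 1 / 2 →
      ConeLe P (d (S x) (S y)) (s • d (S x) (S y) +
        s • (d (T x) (T y) + (2 : ℝ) • d (S x) (T x))) →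
      ConeLe P (d (S x) (S y)) ((s / (1 - s)) • d (T x) (T y) +
        (s / (1 - s) * 2) • d (S x) (T x)) := by
    intro s hs hle
    have := hP.coneLe_of_coneLe_smul_add (show s < 1 by linarith) hle
    rwa [smul_add, smul_smul] at this
  rcases h x y with h | h | h
  · exact key a (by simp) 0 zero_le_two (by simpa using h)
  · refine key _ (by simp) _ (by linarith) (solve b hb1 (hP.coneLe_trans h ?_))
    have h₁ := hd.triangle (S y) (T y) (S x)
    have h₂ := hd.triangle (S x) (T y) (T x)
    rw [hd.symm (S y) (S x)] at h₁
    have h' := hP.smul_mem hb0 (hP.add_mem h₁ h₂)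
    rw [ConeLe]
    convert h' using 1
    module
  · refine key _ (by simp) _ (by linarith) (solve c hc1 (hP.coneLe_trans h ?_))
    have h₁ := hd.triangle (S y) (T x) (S x)
    have h₂ := hd.triangle (S x) (T y) (T x)
    rw [hd.symm (S y) (S x)] at h₁
    have h' := hP.smul_mem hc0 (hP.add_mem h₁ h₂)
    rw [ConeLe]
    convert h' using 1
    module

/-- Along a Jungck step `T y = S x`, a generalized Zamfirescu pair contracts uniformly. -/
theorem IsGZO.exists_coneLe_smul_of_eq (hP : IsCone P) (hd : IsConeMetric P d)
    (h : IsGZO P d S T a b c) :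
    ∃ δ : ℝ, 0 ≤ δ ∧ δ < 1 ∧
      ∀ x y, T y = S x → ConeLe P (d (S x) (S y)) (δ • d (T x) (S x)) := by
  obtain ⟨ha0, ha1, hb0, hb1, hc0, hc1, h⟩ := h
  have hb := div_one_sub_lt_one_of_lt_half hb1
  have hc := div_one_sub_lt_one_of_lt_half hc1
  refine ⟨max a (max (b / (1 - b)) (c / (1 - c))), le_max_of_le_left ha0,
    by simp [ha1, hb, hc], fun x y hxy => ?_⟩
  have key : ∀ s : ℝ, s ≤ max a (max (b / (1 - b)) (c / (1 - c))) →
      ConeLe P (d (S x) (S y)) (s • d (T x) (S x)) →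
      ConeLe P (d (S x) (S y)) (max a (max (b / (1 - b)) (c / (1 - c))) • d (T x) (S x)) :=
    fun s hs hst => hP.coneLe_trans hst (hP.coneLe_smul_of_le hs (hd.mem _ _))
  have hxy' := h x y
  rw [hxy, hd.self, zero_add, hd.symm (S x) (T x), hd.symm (S y) (S x)] at hxy'
  rcases hxy' with h | h | h
  · exact key a (by simp) h
  · refine key (b / (1 - b)) (by simp) (hP.coneLe_of_coneLe_smul_add (by linarith) ?_)
    rwa [← smul_add, add_comm]
  · refine key (c / (1 - c)) (by simp) (hP.coneLe_of_coneLe_smul_add (by linarith)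
      (hP.coneLe_trans h ?_))
    have h₁ := hd.triangle (S y) (T x) (S x)
    rw [hd.symm (S y) (S x), hd.symm (S x) (T x)] at h₁
    rw [← smul_add]
    exact hP.coneLe_smul hc0 h₁

/-- Two coincidence points of a generalized weak contraction have the same image. -/
theorem IsGWC.map_eq_of_coincidence (hP : IsCone P) (hd : IsConeMetric P d) (h : IsGWC P d S T)
    {x y : M} (hx : S x = T x) (hy : S y = T y) : S x = S y := by
  obtain ⟨δ, L, -, hδ, -, h⟩ := h
  have hxy := h x y
  rw [← hx, ← hy, hd.self, smul_zero, add_zero] at hxy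
  exact hd.eq_of_coneLe_smul hP hδ hxy

/-- If `u` is a Jungck orbit of a commuting weak contraction, that is `S (u n) = T (u (n + 1))`,
then a limit of `u` is a coincidence point. -/
theorem IsGWC.coincidence_of_coneConv {K : ℝ} (hP : IsCone P) (hint : (interior P).Nonempty)
    (hK : IsNormalCone P K) (hd : IsConeMetric P d) (h : IsGWC P d S T)
    (hT : ConeSeqContinuous P d T) {u : ℕ → M} {z : M} (hu : ∀ n, S (u n) = T (u (n + 1)))
    (hz : ConeConv P d u z) : S z = T z := by
  obtain ⟨δ, L, -, -, hL, h⟩ := h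
  have hTu : Tendsto (fun n => d (T (u n)) (T z)) atTop (𝓝 0) :=
    (hT u z hz).tendsto hP hint hK hd
  have hSu : Tendsto (fun n => d (S (u n)) (T z)) atTop (𝓝 0) := by
    simpa only [hu, Function.comp_def] using hTu.comp (tendsto_add_atTop_nat 1)
  refine hd.eq_of_tendsto hK (u := fun n => S (u n)) ?_ hSu
  refine hK.tendsto_zero_of_coneLe (fun n => hd.mem _ _)
    (w := fun n => δ • d (T (u n)) (T z) + L • (d (S (u n)) (T z) + d (T (u n)) (T z)))
    (fun n => hP.coneLe_trans (h (u n) z) ?_) ?_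
  · have htri := hd.triangle (S (u n)) (T (u n)) (T z)
    rw [hd.symm (T z) (T (u n))] at htri
    have h' := hP.coneLe_smul hL htri
    simpa [ConeLe] using h'
  · simpa using (hTu.const_smul δ).add ((hSu.add hTu).const_smul L)

end Zamfirescu

/-- Common fixed point theorem for a pair of generalized Zamfirescu operators in a
complete cone metric space. -/
theorem gzo_cone_fixed_point {E M : Type*} [NormedAddCommGroup E] [NormedSpace ℝ E]
    [CompleteSpace E] [Nonempty M]
    (P : Set E) (K : ℝ) (d : M → M → E)
    (hP : IsCone P) (hint : (interior P).Nonempty) (hK : IsNormalCone P K)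
    (hd : IsConeMetric P d) (hcomp : ConeComplete P d)
    (S T : M → M)
    (hGZO : ∃ a b c : ℝ, IsGZO P d S T a b c)
    (hT : ConeSeqContinuous P d T)
    (hrange : Set.range S ⊆ Set.range T)
    (hcomm : ∀ x : M, S (T x) = T (S x)) :
    ∃! z : M, S z = z ∧ T z = z := by
  obtain ⟨a, b, c, hGZO⟩ := hGZO
  have hGWC := hGZO.isGWC hP hd
  obtain ⟨δ, hδ0, hδ1, hδ⟩ := hGZO.exists_coneLe_smul_of_eq hP hd
  choose f hf using fun x => hrange (Set.mem_range_self x)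
  obtain ⟨x₀⟩ := ‹Nonempty M›
  have hx : ∀ n, T (f^[n + 1] x₀) = S (f^[n] x₀) := fun n => by
    rw [Function.iterate_succ_apply', hf]
  obtain ⟨z, hz⟩ := hcomp (fun n => S (f^[n] x₀)) <|
    coneCauchy_of_coneLe_geometric hP hd hδ0 hδ1 fun n => by
      simpa only [hx] using hδ (f^[n + 1] x₀) (f^[n + 2] x₀) (hx (n + 1))
  have hSz : S z = T z := hGWC.coincidence_of_coneConv hP hint hK hd hT
    (fun n => by rw [← hx, hcomm]) hz
  have hSSz : S (S z) = T (S z) := by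
    rw [← hcomm, ← hSz]
  have hfix : S (S z) = S z := hGWC.map_eq_of_coincidence hP hd hSSz hSz
  refine ⟨S z, ⟨hfix, hSSz.symm.trans hfix⟩, ?_⟩
  rintro w ⟨hSw, hTw⟩
  rw [← hSw]
  exact hGWC.map_eq_of_coincidence hP hd (hSw.trans hTw.symm) hSz
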